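/- Let φ be an N-function with the good φ' property with constant G, and let V on real symmetric d×d matrices be V(Q) = √(φ'(|Q|)/|Q|)·Q for Q ≠ 0, V(0) = 0. Then there exist constants c, C > 0 depending only on G such that for all symmetric d×d matrices P, Q with |P| + |Q| > 0: c·φ''(|P|+|Q|)·|P−Q|² ≤ φ_{|P|}(|P−Q|) ≤ C·φ''(|P|+|Q|)·|P−Q|² and c·|V(P) − V(Q)|² ≤ φ_{|P|}(|P−Q|) ≤ C·|V(P) − V(Q)|² (equivalences (56) of Proposition 5). -/

import Mathlib

open MeasureTheory Real Set Filter

noncomputable section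

/-- `φ` is an N-function with right-continuous, non-decreasing density `φ'`:
`φ t = ∫₀ᵗ φ'`, `φ'(0) = 0`, `φ' > 0` on `(0,∞)`, `φ'(t) → ∞` as `t → ∞`. -/
def IsNFunction (φ φ' : ℝ → ℝ) : Prop :=
  (∀ t, 0 ≤ t → φ t = ∫ s in (0:ℝ)..t, φ' s) ∧
  (∀ s, 0 ≤ s → 0 ≤ φ' s) ∧
  (∀ s t, 0 ≤ s → s ≤ t → φ' s ≤ φ' t) ∧
  φ' 0 = 0 ∧
  (∀ t, 0 < t → 0 < φ' t) ∧
  Filter.Tendsto φ' Filter.atTop Filter.atTop ∧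
  (∀ t, 0 ≤ t → ContinuousWithinAt φ' (Set.Ici t) t)

/-- The Δ₂ condition with constant `K`: `φ(2t) ≤ K·φ(t)` for all `t ≥ 0`. -/
def Delta2 (φ : ℝ → ℝ) (K : ℝ) : Prop := ∀ t, 0 ≤ t → φ (2 * t) ≤ K * φ t

/-- The complementary (conjugate) function `φ*(t) = sup_{s ≥ 0} (t·s − φ(s))`. -/
def conjFn (φ : ℝ → ℝ) (t : ℝ) : ℝ := sSup {x | ∃ s, 0 ≤ s ∧ x = t * s - φ s}

/-- The good `φ'` property with constant `G ≥ 1`: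
`φ` is `C¹` on `[0,∞)` and `C²` on `(0,∞)` with
`G⁻¹·φ'(t) ≤ t·φ''(t) ≤ G·φ'(t)` for `t > 0`. -/
def GoodPhi (φ φ' φ'' : ℝ → ℝ) (G : ℝ) : Prop :=
  1 ≤ G ∧
  (∀ t, 0 < t → HasDerivAt φ (φ' t) t) ∧
  (∀ t, 0 < t → HasDerivAt φ' (φ'' t) t) ∧
  ContinuousWithinAt φ' (Set.Ici 0) 0 ∧
  (∀ t, 0 < t → ContinuousAt φ'' t) ∧
  (∀ t, 0 < t → G⁻¹ * φ' t ≤ t * φ'' t ∧ t * φ'' t ≤ G * φ' t)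

/-- Shifted N-function `φ_a(t) = ∫₀ᵗ φ'(a+s)·s/(a+s) ds`. -/
def shPhi (φ' : ℝ → ℝ) (a t : ℝ) : ℝ := ∫ s in (0:ℝ)..t, φ' (a + s) * s / (a + s)

/-- Derivative of the shifted N-function: `φ'_a(t) = φ'(a+t)·t/(a+t)`. -/
def shPhi' (φ' : ℝ → ℝ) (a t : ℝ) : ℝ := φ' (a + t) * t / (a + t)

/-- The square-root N-function `φ̄(t) = ∫₀ᵗ √(s·φ'(s)) ds`. -/
def barPhi (φ' : ℝ → ℝ) (t : ℝ) : ℝ := ∫ s in (0:ℝ)..t, Real.sqrt (s * φ' s)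

/-- Derivative of the square-root N-function: `φ̄'(t) = √(t·φ'(t))`. -/
def barPhi' (φ' : ℝ → ℝ) (t : ℝ) : ℝ := Real.sqrt (t * φ' t)

/-- Frobenius inner product `P : Q = ∑ᵢⱼ Pᵢⱼ·Qᵢⱼ`. -/
def minner {d : ℕ} (P Q : Matrix (Fin d) (Fin d) ℝ) : ℝ := ∑ i, ∑ j, P i j * Q i j

/-- Frobenius norm `|P| = √(P : P)`. -/
def fnorm {d : ℕ} (P : Matrix (Fin d) (Fin d) ℝ) : ℝ := Real.sqrt (minner P P)

/-- The tensor `Q ↦ g(|Q|)·Q/|Q|` (with value `0` at `Q = 0`). -/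
def tensorT {d : ℕ} (g : ℝ → ℝ) (Q : Matrix (Fin d) (Fin d) ℝ) :
    Matrix (Fin d) (Fin d) ℝ :=
  if Q = 0 then 0 else (g (fnorm Q) / fnorm Q) • Q


lemma power_bd {φ φ' φ'' : ℝ → ℝ} {G : ℝ} (hG : GoodPhi φ φ' φ'' G) {x y : ℝ}
    (hx : 0 < x) (hxy : x ≤ y) : φ' y ≤ (y / x) ^ G * φ' x := by
  obtain ⟨_, _, h2, _, _, h5⟩ := hG
  have hd : ∀ t : ℝ, 0 < t → HasDerivAt (fun t => φ' t * t ^ (-G))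
      (φ'' t * t ^ (-G) + φ' t * (-G * t ^ (-G - 1))) t := by
    intro t ht
    exact (h2 t ht).mul (Real.hasDerivAt_rpow_const (Or.inl ht.ne'))
  have hanti : AntitoneOn (fun t => φ' t * t ^ (-G)) (Set.Ioi 0) := by
    apply antitoneOn_of_deriv_nonpos (convex_Ioi 0)
    · intro t ht
      exact (hd t ht).continuousAt.continuousWithinAt
    · intro t ht
      rw [interior_Ioi] at ht
      exact (hd t ht).differentiableAt.differentiableWithinAt
    · intro t ht
      rw [interior_Ioi] at ht
      have ht' : 0 < t := ht
      rw [(hd t ht).deriv]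
      have e : t ^ (-G) = t * t ^ (-G - 1) := by
        rw [Real.rpow_sub_one ht'.ne']; field_simp
      rw [e]
      have := Real.rpow_pos_of_pos ht' (-G - 1)
      have := (h5 t ht').2
      nlinarith
  have hy : 0 < y := hx.trans_le hxy
  have := hanti hx hy hxy
  simp only [Real.rpow_neg hx.le, Real.rpow_neg hy.le] at this
  rw [Real.div_rpow hy.le hx.le]
  have h1 := Real.rpow_pos_of_pos hx G
  have h2 := Real.rpow_pos_of_pos hy G
  rw [← div_eq_mul_inv, ← div_eq_mul_inv, div_le_div_iff₀ h2 h1] at this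
  rw [div_mul_eq_mul_div, le_div_iff₀ h1]
  linarith

lemma dbl {φ φ' φ'' : ℝ → ℝ} {G : ℝ} (hG : GoodPhi φ φ' φ'' G) {x : ℝ}
    (hx : 0 < x) : φ' (2 * x) ≤ 2 ^ G * φ' x := by
  have := power_bd hG hx (y := 2 * x) (by linarith)
  rwa [mul_div_assoc, div_self hx.ne', mul_one] at this

lemma bern {φ φ' φ'' : ℝ → ℝ} {G : ℝ} (hG : GoodPhi φ φ' φ'' G) {x y : ℝ}
    (hx : 0 < x) (hxy : x ≤ y) (hf : 0 ≤ φ' y) : y * (φ' y - φ' x) ≤ G * φ' y * (y - x) := by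
  have h := power_bd hG hx hxy
  have hy : 0 < y := hx.trans_le hxy
  have hr : 0 < (x / y) ^ G := Real.rpow_pos_of_pos (by positivity) G
  have hb := one_add_mul_self_le_rpow_one_add (s := x / y - 1) (by
    have : 0 < x / y := by positivity
    linarith) hG.1
  rw [add_sub_cancel] at hb
  have e : (x / y) ^ G * (y / x) ^ G = 1 := by
    rw [← Real.mul_rpow (by positivity) (by positivity)]
    have : x / y * (y / x) = 1 := by field_simp
    rw [this, Real.one_rpow]
  have h3 : (x / y) ^ G * φ' y ≤ φ' x := by
    calc _ ≤ (x / y) ^ G * ((y / x) ^ G * φ' x) := by gcongr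
      _ = φ' x := by rw [← mul_assoc, e, one_mul]
  have h4 : (1 + G * (x / y - 1)) * φ' y ≤ φ' x := (mul_le_mul_of_nonneg_right hb hf).trans h3
  have h5 := mul_le_mul_of_nonneg_left h4 hy.le
  have e2 : y * ((1 + G * (x / y - 1)) * φ' y) = (y + G * (x - y)) * φ' y := by field_simp
  rw [e2] at h5
  nlinarith

lemma sh_bd {φ φ' φ'' : ℝ → ℝ} {G : ℝ} (hN : IsNFunction φ φ') (hG : GoodPhi φ φ' φ'' G)
    {a b t : ℝ} (ha : 0 ≤ a) (hb : 0 ≤ b) (hs : 0 < a + b) (ht : 0 ≤ t) (h1 : t ≤ a + b)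
    (h2 : b ≤ a + t) :
    φ' (a + b) / (a + b) * t ^ 2 ≤ 8 * (2 ^ G) ^ 2 * shPhi φ' a t ∧
    shPhi φ' a t ≤ 2 * 2 ^ G * (φ' (a + b) / (a + b) * t ^ 2) := by
  obtain ⟨_, hnn, hm, h0, hpos, _, _⟩ := hN
  rcases ht.eq_or_lt with rfl | ht
  · simp [shPhi]
  set K : ℝ := 2 ^ G
  have hK : 0 < K := Real.rpow_pos_of_pos two_pos G
  have hmono : MonotoneOn (fun s => φ' (a + s) * s / (a + s)) (Set.Icc 0 t) := by
    intro x hx y hy hxy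
    have hx0 := hx.1
    rcases hx0.eq_or_lt with h | hx0
    · simp only [← h, mul_zero, zero_div]
      have := hnn (a + y) (by linarith [hy.1])
      have := hy.1
      positivity
    · have hax : 0 < a + x := by linarith
      have hay : 0 < a + y := by linarith
      have hfx := hnn (a + x) hax.le
      have hfm := hm (a + x) (a + y) hax.le (by linarith)
      simp only [mul_div_assoc]
      apply mul_le_mul hfm _ (by positivity) (hfx.trans hfm)
      rw [div_le_div_iff₀ hax hay]
      nlinarith
  have hint : ∀ u v : ℝ, 0 ≤ u → u ≤ v → v ≤ t →
      IntervalIntegrable (fun s => φ' (a + s) * s / (a + s)) volume u v := by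
    intro u v hu huv hv
    apply MonotoneOn.intervalIntegrable
    apply hmono.mono
    rw [Set.uIcc_of_le huv]
    exact Set.Icc_subset_Icc hu hv
  have hat : 0 < a + t := by linarith
  have ha2 : 0 < a + t / 2 := by linarith
  have hfs := hpos _ hs
  constructor
  · have hsplit : shPhi φ' a t = (∫ s in (0:ℝ)..(t/2), φ' (a + s) * s / (a + s)) +
        ∫ s in (t/2)..t, φ' (a + s) * s / (a + s) := by
      unfold shPhi
      rw [intervalIntegral.integral_add_adjacent_intervals]
      · exact hint _ _ le_rfl (by linarith) (by linarith)
      · exact hint _ _ (by linarith) (by linarith) (by linarith)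
    have hA : 0 ≤ ∫ s in (0:ℝ)..(t/2), φ' (a + s) * s / (a + s) := by
      apply intervalIntegral.integral_nonneg (by linarith)
      intro u hu
      have := hu.1
      have := hnn (a + u) (by linarith)
      positivity
    have hB : t / 2 * (φ' (a + t/2) * (t/2) / (a + t/2)) ≤
        ∫ s in (t/2)..t, φ' (a + s) * s / (a + s) := by
      have := intervalIntegral.integral_mono_on (μ := volume) (a := t/2) (b := t)
        (f := fun _ => φ' (a + t/2) * (t/2) / (a + t/2)) (by linarith)
        (by simp) (hint (t/2) t (by linarith) (by linarith) le_rfl)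
        (fun u hu => hmono ⟨by linarith, by linarith⟩ ⟨by linarith [hu.1], hu.2⟩ hu.1)
      rw [intervalIntegral.integral_const, smul_eq_mul] at this
      have e : t - t / 2 = t / 2 := by ring
      rwa [e] at this
    have hq : φ' (a + b) ≤ K ^ 2 * φ' (a + t / 2) := by
      have d1 := dbl hG (x := (a + b) / 4) (by linarith)
      have d2 := dbl hG (x := (a + b) / 2) (by linarith)
      have d3 := hm ((a + b) / 4) (a + t / 2) (by linarith) (by linarith)
      rw [show 2 * ((a + b) / 4) = (a + b) / 2 by ring] at d1
      rw [show 2 * ((a + b) / 2) = a + b by ring] at d2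
      calc _ ≤ K * φ' ((a + b) / 2) := d2
        _ ≤ K * (K * φ' ((a + b) / 4)) := by gcongr
        _ ≤ K * (K * φ' (a + t / 2)) := by gcongr
        _ = _ := by ring
    have hfa := hpos _ ha2
    calc φ' (a + b) / (a + b) * t ^ 2
        ≤ (K ^ 2 * φ' (a + t / 2)) / ((a + t / 2) / 2) * t ^ 2 := by
          gcongr
          linarith
      _ = 8 * K ^ 2 * (t / 2 * (φ' (a + t/2) * (t/2) / (a + t/2))) := by field_simp; ring
      _ ≤ 8 * K ^ 2 * shPhi φ' a t := by
          gcongr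
          linarith
  · have hB : shPhi φ' a t ≤ t * (φ' (a + t) * t / (a + t)) := by
      have := intervalIntegral.integral_mono_on (μ := volume) (a := 0) (b := t)
        (g := fun _ => φ' (a + t) * t / (a + t)) ht.le
        (hint 0 t le_rfl ht.le le_rfl) (by simp)
        (fun u hu => hmono hu ⟨ht.le, le_rfl⟩ hu.2)
      rw [intervalIntegral.integral_const, smul_eq_mul, sub_zero] at this
      exact this
    have d1 := dbl hG hs
    have d2 := hm (a + t) (2 * (a + b)) hat.le (by linarith)
    calc _ ≤ t * (φ' (a + t) * t / (a + t)) := hB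
      _ ≤ t * ((K * φ' (a + b)) * t / ((a + b) / 2)) := by
        gcongr
        · exact d2.trans d1
        · linarith
      _ = _ := by field_simp

lemma arith1 {U Z X Y L : ℝ} (h1 : U ≤ L * X) (h2 : Z ≤ 16 * (X + Y)) (h3 : 0 ≤ L * Y) :
    U + Z ≤ (L + 16) * (X + Y) := by
  linarith

lemma arith2 {U Z X Y K : ℝ} (hK : 1 ≤ K) (hU : 0 ≤ U) (hZ : 0 ≤ Z) (h1 : X ≤ 4 * U)
    (h2 : Y ≤ K * Z + 8 * X) : X + Y ≤ 36 * K * (U + Z) := by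
  have a1 : U ≤ K * U := le_mul_of_one_le_left hU hK
  have a2 : 0 ≤ K * Z := mul_nonneg (by linarith) hZ
  linarith

set_option maxHeartbeats 1000000 in
lemma core {φ φ' φ'' : ℝ → ℝ} {G : ℝ} (hN : IsNFunction φ φ') (hG : GoodPhi φ φ' φ'' G)
    {a b m p q : ℝ} (ha : 0 < a) (hb : 0 ≤ b) (hba : b ≤ a) (hm1 : m ≤ a * b)
    (hm2 : -(a * b) ≤ m) (hp : p = √(a * φ' a) / a) (hq : q = √(b * φ' b) / b) :
    p ^ 2 * a ^ 2 + q ^ 2 * b ^ 2 - 2 * p * q * m ≤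
      2 * ((1 + G) ^ 2 + 16) * (φ' (a + b) / (a + b) * (a ^ 2 + b ^ 2 - 2 * m)) ∧
    φ' (a + b) / (a + b) * (a ^ 2 + b ^ 2 - 2 * m) ≤
      36 * (2 ^ G) ^ 2 * (p ^ 2 * a ^ 2 + q ^ 2 * b ^ 2 - 2 * p * q * m) := by
  obtain ⟨_, hnn, hm, h0, hpos, _, _⟩ := hN
  have hG1 := hG.1
  set K : ℝ := 2 ^ G
  have hK1 : 1 ≤ K := Real.one_le_rpow one_le_two (by linarith)
  have hs : 0 < a + b := by linarith
  have hfa := hpos a ha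
  have hfb := hnn b hb
  have hfba := hm b a hb hba
  have hp0 : 0 < p := by rw [hp]; positivity
  have hq0 : 0 ≤ q := by rw [hq]; positivity
  have hpa : p ^ 2 * a = φ' a := by
    rw [hp, div_pow, Real.sq_sqrt (by positivity)]; field_simp
  have hqb : q ^ 2 * b = φ' b := by
    rcases hb.eq_or_lt with h | h
    · rw [← h, h0, mul_zero]
    · rw [hq, div_pow, Real.sq_sqrt (by positivity)]; field_simp
  have hKa : φ' (a + b) ≤ K * φ' a :=
    (hm _ (2 * a) hs.le (by linarith)).trans (dbl hG ha)
  have hsa := hm a (a + b) ha.le (by linarith)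
  set W := φ' (a + b) / (a + b) with hW
  have hWp : W ≤ K * p ^ 2 := by
    rw [hW, div_le_iff₀ hs]
    have : 0 ≤ K * p ^ 2 * b := by positivity
    nlinarith
  have hpW : p ^ 2 ≤ 2 * W := by
    have : W * (a + b) = φ' (a + b) := by rw [hW]; field_simp
    have hW0 : 0 ≤ W := by rw [hW]; have := hpos _ hs; positivity
    have : p ^ 2 * a ≤ 2 * W * a := by nlinarith
    exact le_of_mul_le_mul_right this ha
  -- D
  obtain ⟨D, hD⟩ : ∃ D, D = 2 * (a * b - m) := ⟨_, rfl⟩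
  have hD0 : 0 ≤ D := by linarith
  have hD4 : D ≤ 4 * (a * b) := by linarith
  have eT : a ^ 2 + b ^ 2 - 2 * m = (a - b) ^ 2 + D := by rw [hD]; ring
  have eN : p ^ 2 * a ^ 2 + q ^ 2 * b ^ 2 - 2 * p * q * m = (p * a - q * b) ^ 2 + p * q * D := by
    rw [hD]; ring
  rw [eT, eN]
  have hT0 : 0 ≤ (a - b) ^ 2 + D := by positivity
  -- comparison of p a and q b
  have hqp : q * b ≤ p * a := by
    apply le_of_sq_le_sq _ (by positivity)
    have : (q * b) ^ 2 = b * φ' b := by rw [← hqb]; ring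
    have : (p * a) ^ 2 = a * φ' a := by rw [← hpa]; ring
    nlinarith
  have hup : p * a - q * b ≤ (1 + G) * p * (a - b) := by
    rcases hb.eq_or_lt with h | h
    · rw [← h]; nlinarith [mul_pos hp0 ha]
    · have hB := bern hG h hba hfa.le
      have hpa0 : 0 < p * a := by positivity
      have hqb0 : 0 ≤ q * b := by positivity
      have k1 : (p * a - q * b) * (p * a) ≤ a * φ' a - b * φ' b := by
        rw [← hpa, ← hqb]; nlinarith [mul_nonneg hqb0 (sub_nonneg.2 hqp)]
      have k2 : a * φ' a - b * φ' b ≤ (1 + G) * φ' a * (a - b) := by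
        nlinarith [mul_nonneg (sub_nonneg.2 hba) (sub_nonneg.2 hfba)]
      have k3 : (1 + G) * φ' a * (a - b) = (1 + G) * p * (a - b) * (p * a) := by
        rw [← hpa]; ring
      exact le_of_mul_le_mul_right (by linarith) hpa0
  have hlo : p * (a - b) ≤ 2 * (p * a - q * b) := by
    -- 2 q b ≤ p (a + b)
    have : 2 * (q * b) ≤ p * (a + b) := by
      apply le_of_sq_le_sq _ (by positivity)
      have e1 : (2 * (q * b)) ^ 2 = 4 * b * φ' b := by rw [← hqb]; ring
      have e2 : 4 * b * φ' b ≤ 4 * b * φ' a := by gcongr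
      have e3 : 4 * b * φ' a = p ^ 2 * (4 * a * b) := by rw [← hpa]; ring
      rw [e1, mul_pow]
      nlinarith [mul_nonneg (sq_nonneg p) (sq_nonneg (a - b))]
    linarith
  have hdiff : (p * a - q * b) ^ 2 ≤ (1 + G) ^ 2 * (p ^ 2 * (a - b) ^ 2) := by
    calc _ ≤ ((1 + G) * p * (a - b)) ^ 2 := by
          apply pow_le_pow_left₀ (by linarith) hup
      _ = _ := by ring
  have hdifflo : p ^ 2 * (a - b) ^ 2 ≤ 4 * (p * a - q * b) ^ 2 := by
    calc _ = (p * (a - b)) ^ 2 := by ring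
      _ ≤ (2 * (p * a - q * b)) ^ 2 := by
          apply pow_le_pow_left₀ (mul_nonneg hp0.le (by linarith)) hlo
      _ = _ := by ring
  have key : (p * a - q * b) ^ 2 + p * q * D ≤ ((1 + G) ^ 2 + 16) * (p ^ 2 * ((a - b) ^ 2 + D)) ∧
      p ^ 2 * ((a - b) ^ 2 + D) ≤ 36 * K * ((p * a - q * b) ^ 2 + p * q * D) := by
    have z1 : 0 ≤ p ^ 2 * (a - b) ^ 2 := by positivity
    have z2 : 0 ≤ p ^ 2 * D := by positivity
    have z3 : 0 ≤ p * q * D := by positivity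
    have z4 : 0 ≤ (1 + G) ^ 2 * (p ^ 2 * D) := by positivity
    rw [mul_add (p ^ 2)]
    have z5 := sq_nonneg (p * a - q * b)
    rcases le_or_gt a (2 * b) with hc | hc
    · have hb0 : 0 < b := by linarith
      have hq2 : q ≤ 2 * p := by
        apply le_of_sq_le_sq _ (by positivity)
        have : q ^ 2 * b ≤ (2 * p) ^ 2 * b := by nlinarith [sq_nonneg p]
        exact le_of_mul_le_mul_right this hb0
      have hq3 : p ≤ K * q := by
        apply le_of_sq_le_sq _ (by positivity)
        have g1 : φ' a ≤ K * φ' b := (hm _ (2 * b) ha.le hc).trans (dbl hG hb0)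
        have : p ^ 2 * a ≤ (K * q) ^ 2 * a := by
          calc _ = φ' a := hpa
            _ ≤ K * φ' b := g1
            _ = K * 1 * (q ^ 2 * b) := by rw [hqb]; ring
            _ ≤ K * K * (q ^ 2 * a) := by gcongr
            _ = _ := by ring
        exact le_of_mul_le_mul_right this ha
      have y1 : p * q * D ≤ 2 * (p ^ 2 * D) := by
        calc _ ≤ p * (2 * p) * D := by gcongr
          _ = _ := by ring
      have y2 : p ^ 2 * D ≤ K * (p * q * D) := by
        calc _ = p * p * D := by ring
          _ ≤ p * (K * q) * D := by gcongr
          _ = _ := by ring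
      constructor
      · exact arith1 hdiff (by linarith) z4
      · exact arith2 hK1 z5 z3 hdifflo (by linarith)
    · have y0 : D ≤ 8 * (a - b) ^ 2 := by nlinarith
      have y1 : p * q * D ≤ 16 * (p ^ 2 * (a - b) ^ 2) := by
        calc p * q * D ≤ p * q * (4 * (a * b)) := by gcongr
          _ = 4 * (p * a) * (q * b) := by ring
          _ ≤ 4 * (p * a) * (p * a) := by gcongr
          _ = 4 * p ^ 2 * a ^ 2 := by ring
          _ ≤ 4 * p ^ 2 * (2 * (a - b)) ^ 2 := by
            gcongr
            linarith
          _ = _ := by ring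
      constructor
      · exact arith1 hdiff (by linarith) z4
      · have y2 : p ^ 2 * D ≤ p ^ 2 * (8 * (a - b) ^ 2) := by gcongr
        have : 0 ≤ K * (p * q * D) := by positivity
        exact arith2 hK1 z5 z3 hdifflo (by linarith)
  constructor
  · calc _ ≤ ((1 + G) ^ 2 + 16) * (p ^ 2 * ((a - b) ^ 2 + D)) := key.1
      _ ≤ ((1 + G) ^ 2 + 16) * ((2 * W) * ((a - b) ^ 2 + D)) := by gcongr
      _ = _ := by ring
  · calc W * ((a - b) ^ 2 + D) ≤ K * p ^ 2 * ((a - b) ^ 2 + D) := by gcongr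
      _ = K * (p ^ 2 * ((a - b) ^ 2 + D)) := by ring
      _ ≤ K * (36 * K * ((p * a - q * b) ^ 2 + p * q * D)) := by
        exact mul_le_mul_of_nonneg_left key.2 (by linarith)
      _ = _ := by ring

lemma minner_self_nonneg {d : ℕ} (P : Matrix (Fin d) (Fin d) ℝ) : 0 ≤ minner P P :=
  Finset.sum_nonneg fun _ _ => Finset.sum_nonneg fun _ _ => mul_self_nonneg _

lemma fnorm_sq {d : ℕ} (P : Matrix (Fin d) (Fin d) ℝ) : fnorm P ^ 2 = minner P P :=
  Real.sq_sqrt (minner_self_nonneg P)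

lemma fnorm_nonneg {d : ℕ} (P : Matrix (Fin d) (Fin d) ℝ) : 0 ≤ fnorm P := Real.sqrt_nonneg _

lemma fnorm_comb {d : ℕ} (P Q : Matrix (Fin d) (Fin d) ℝ) (p q : ℝ) :
    fnorm (p • P - q • Q) ^ 2 =
      p ^ 2 * fnorm P ^ 2 + q ^ 2 * fnorm Q ^ 2 - 2 * p * q * minner P Q := by
  simp only [fnorm_sq, minner, Finset.mul_sum, ← Finset.sum_add_distrib, ← Finset.sum_sub_distrib]
  refine Finset.sum_congr rfl fun i _ => Finset.sum_congr rfl fun j _ => ?_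
  simp only [Matrix.sub_apply, Matrix.smul_apply, smul_eq_mul]
  ring

lemma minner_abs {d : ℕ} (P Q : Matrix (Fin d) (Fin d) ℝ) :
    |minner P Q| ≤ fnorm P * fnorm Q := by
  apply abs_le_of_sq_le_sq _ (mul_nonneg (fnorm_nonneg P) (fnorm_nonneg Q))
  rw [mul_pow, fnorm_sq, fnorm_sq]
  simp only [minner, ← Fintype.sum_prod_type', ← pow_two]
  exact Finset.sum_mul_sq_le_sq_mul_sq _ (fun x : Fin d × Fin d => P x.1 x.2) (fun x => Q x.1 x.2)

lemma tensor_eq {d : ℕ} (g : ℝ → ℝ) (Q : Matrix (Fin d) (Fin d) ℝ) :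
    tensorT g Q = (g (fnorm Q) / fnorm Q) • Q := by
  unfold tensorT
  split_ifs with h
  · rw [h, smul_zero]
  · rfl

lemma V_bd {φ φ' φ'' : ℝ → ℝ} {G : ℝ} (hN : IsNFunction φ φ') (hG : GoodPhi φ φ' φ'' G)
    {d : ℕ} (P Q : Matrix (Fin d) (Fin d) ℝ) (hs : 0 < fnorm P + fnorm Q) :
    fnorm (tensorT (barPhi' φ') P - tensorT (barPhi' φ') Q) ^ 2 ≤
      2 * ((1 + G) ^ 2 + 16) *
        (φ' (fnorm P + fnorm Q) / (fnorm P + fnorm Q) * fnorm (P - Q) ^ 2) ∧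
    φ' (fnorm P + fnorm Q) / (fnorm P + fnorm Q) * fnorm (P - Q) ^ 2 ≤
      36 * (2 ^ G) ^ 2 * fnorm (tensorT (barPhi' φ') P - tensorT (barPhi' φ') Q) ^ 2 := by
  have hT := fnorm_comb P Q 1 1
  simp only [one_smul, one_pow, one_mul, mul_one] at hT
  rw [tensor_eq, tensor_eq, fnorm_comb, hT]
  have hab := abs_le.1 (minner_abs P Q)
  have ha := fnorm_nonneg P
  have hb := fnorm_nonneg Q
  rcases le_total (fnorm Q) (fnorm P) with h | h
  · exact core hN hG (by linarith) hb h hab.2 hab.1 rfl rfl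
  · have := core hN hG (a := fnorm Q) (b := fnorm P) (m := minner P Q) (by linarith) ha h
      (by linarith [hab.2]) (by linarith [hab.1]) rfl rfl
    rw [add_comm (fnorm Q) (fnorm P)] at this
    unfold barPhi'
    constructor
    · refine le_trans (le_of_eq ?_) (this.1.trans (le_of_eq ?_)) <;> ring
    · refine le_trans (le_of_eq ?_) (this.2.trans (le_of_eq ?_)) <;> ring

/-- Equivalences (56): `φ''(|P|+|Q|)·|P−Q|² ∼ φ_{|P|}(|P−Q|) ∼ |V(P)−V(Q)|²`
with constants depending only on `G`, where `V(Q) = √(φ'(|Q|)/|Q|)·Q`. -/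
theorem equivalent_monotonicity_notions :
    ∃ c C : ℝ → ℝ, ∀ (G : ℝ) (d : ℕ) (φ φ' φ'' : ℝ → ℝ),
      IsNFunction φ φ' → GoodPhi φ φ' φ'' G →
      0 < c G ∧ 0 < C G ∧
      ∀ P Q : Matrix (Fin d) (Fin d) ℝ, P.IsSymm → Q.IsSymm →
        0 < fnorm P + fnorm Q →
        (c G * (φ'' (fnorm P + fnorm Q) * fnorm (P - Q) ^ 2) ≤
            shPhi φ' (fnorm P) (fnorm (P - Q)) ∧
          shPhi φ' (fnorm P) (fnorm (P - Q)) ≤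
            C G * (φ'' (fnorm P + fnorm Q) * fnorm (P - Q) ^ 2)) ∧
        (c G * fnorm (tensorT (barPhi' φ') P - tensorT (barPhi' φ') Q) ^ 2 ≤
            shPhi φ' (fnorm P) (fnorm (P - Q)) ∧
          shPhi φ' (fnorm P) (fnorm (P - Q)) ≤
            C G * fnorm (tensorT (barPhi' φ') P - tensorT (barPhi' φ') Q) ^ 2) := by
  refine ⟨fun G => 1 / (8 * (2 ^ G) ^ 2 * (2 * ((1 + G) ^ 2 + 16)) * G),
    fun G => 72 * (2 ^ G) ^ 3 * G, ?_⟩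
  intro G d φ φ' φ'' hN hG
  have hG1 := hG.1
  have hK1 : (1 : ℝ) ≤ 2 ^ G := Real.one_le_rpow one_le_two (by linarith)
  refine ⟨by positivity, by positivity, ?_⟩
  intro P Q _ _ hs
  beta_reduce
  have hV := V_bd hN hG P Q hs
  have hT := fnorm_comb P Q 1 1
  simp only [one_smul, one_pow, one_mul, mul_one] at hT
  have hab := abs_le.1 (minner_abs P Q)
  have ha := fnorm_nonneg P
  have hb := fnorm_nonneg Q
  have ht := fnorm_nonneg (P - Q)
  have hS := sh_bd hN hG ha hb hs ht
    (by apply le_of_sq_le_sq _ hs.le; nlinarith)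
    (by
      by_contra hcon
      push Not at hcon
      have : fnorm (P - Q) < fnorm Q - fnorm P := by linarith
      nlinarith)
  obtain ⟨g1, g2⟩ := hG.2.2.2.2.2 _ hs
  have hfs := hN.2.2.2.2.1 _ hs
  generalize shPhi φ' (fnorm P) (fnorm (P - Q)) = S at *
  generalize fnorm (tensorT (barPhi' φ') P - tensorT (barPhi' φ') Q) ^ 2 = N at *
  have hT0 : 0 ≤ fnorm (P - Q) ^ 2 := sq_nonneg _
  clear hT
  generalize fnorm (P - Q) ^ 2 = T at *
  generalize fnorm P + fnorm Q = s at *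
  have hG0 : 0 < G := by linarith
  have A : φ' s / s ≤ G * φ'' s := by
    rw [div_le_iff₀ hs]
    rw [inv_mul_le_iff₀ hG0] at g1
    linarith
  have B : φ'' s ≤ G * (φ' s / s) := by
    rw [← mul_div_assoc, le_div_iff₀ hs]
    linarith
  have hW0 : 0 ≤ φ' s / s := by positivity
  generalize φ' s / s = W at *
  generalize φ'' s = w at *
  generalize (2 : ℝ) ^ G = K at *
  obtain ⟨S1, S2⟩ := hS
  obtain ⟨V1, V2⟩ := hV
  obtain ⟨M, hM⟩ : ∃ M, M = 2 * ((1 + G) ^ 2 + 16) := ⟨_, rfl⟩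
  have hM1 : 1 ≤ M := by rw [hM]; nlinarith [sq_nonneg (1 + G)]
  have hWT : 0 ≤ W * T := mul_nonneg hW0 hT0
  have hS0 : 0 ≤ 8 * K ^ 2 * S := hWT.trans S1
  have AT : W * T ≤ G * (w * T) := by
    calc _ ≤ G * w * T := by gcongr
      _ = _ := by ring
  have BT : w * T ≤ G * (W * T) := by
    calc _ ≤ G * W * T := by gcongr
      _ = _ := by ring
  have hN0 : 0 ≤ N := by
    have : 0 ≤ 36 * K ^ 2 * N := hWT.trans V2
    exact nonneg_of_mul_nonneg_right this (by positivity)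
  have hK3 : K ≤ K ^ 3 := le_self_pow₀ hK1 (by norm_num)
  rw [← hM] at V1 ⊢
  have hwT : 0 ≤ w * T := nonneg_of_mul_nonneg_right (hWT.trans AT) hG0
  refine ⟨⟨?_, ?_⟩, ⟨?_, ?_⟩⟩
  · rw [one_div, inv_mul_le_iff₀ (by positivity)]
    calc w * T ≤ G * (W * T) := BT
      _ ≤ G * (8 * K ^ 2 * S) := by gcongr
      _ ≤ M * (G * (8 * K ^ 2 * S)) := le_mul_of_one_le_left (by positivity) hM1
      _ = _ := by ring
  · calc S ≤ 2 * K * (W * T) := S2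
      _ ≤ 2 * K * (G * (w * T)) := by gcongr
      _ ≤ 72 * K ^ 3 * (G * (w * T)) := by gcongr; norm_num
      _ = _ := by ring
  · rw [one_div, inv_mul_le_iff₀ (by positivity)]
    calc N ≤ M * (W * T) := V1
      _ ≤ M * (8 * K ^ 2 * S) := by gcongr
      _ ≤ G * (M * (8 * K ^ 2 * S)) := le_mul_of_one_le_left (by positivity) hG1
      _ = _ := by ring
  · calc S ≤ 2 * K * (W * T) := S2
      _ ≤ 2 * K * (36 * K ^ 2 * N) := by gcongr
      _ = 72 * K ^ 3 * 1 * N := by ring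
      _ ≤ 72 * K ^ 3 * G * N := by gcongr
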